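/- (Zimin, 1982) Let V be a word with exactly n distinct letters. Then V is unavoidable (i.e., for every positive integer q there are only finitely many q-ary words that avoid V) if and only if Zₙ encounters V. -/

import Mathlib

/-- `W` is an instance of the pattern `V`: the image of `V` under a semigroup
homomorphism sending each letter to a nonempty word. -/
def IsInst {α β : Type} (V : List α) (W : List β) : Prop :=
  ∃ φ : α → List β, (∀ a ∈ V, φ a ≠ []) ∧ W = (V.map φ).flatten

/-- `U` encounters `V`: some contiguous subword (infix) of `U` is an instance of `V`. -/
def Encounters {α β : Type} (U : List β) (V : List α) : Prop :=
  ∃ W : List β, W <:+: U ∧ IsInst V W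

/-- `U` avoids `V`: `U` does not encounter `V`. -/
def Avoids {α β : Type} (U : List β) (V : List α) : Prop :=
  ¬ Encounters U V

/-- The Zimin words over the alphabet ℕ: `Z₀ = ε`, `Z_{n+1} = Zₙ · n · Zₙ`. -/
def Zimin : ℕ → List ℕ
  | 0 => []
  | n + 1 => Zimin n ++ n :: Zimin n

/-- `zimf n q` is the smallest `M` such that every `q`-ary word of length `M`
encounters the Zimin word `Zₙ`. -/
noncomputable def zimf (n q : ℕ) : ℕ :=
  sInf {M : ℕ | ∀ W : List (Fin q), W.length = M → Encounters W (Zimin n)}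

/-- `ZC n q M` is the set of `q`-ary words of length `M` that are instances of `Zₙ`. -/
def ZC (n q M : ℕ) : Set (List (Fin q)) :=
  {W | W.length = M ∧ IsInst (Zimin n) W}

/-! ### Encounters -/

theorem Encounters.mono_left {α β : Type} {U U' : List β} {V : List α}
    (h : Encounters U V) (hU : U <:+: U') : Encounters U' V := by
  obtain ⟨W, hW, hi⟩ := h
  exact ⟨W, hW.trans hU, hi⟩

theorem Encounters.trans {α β γ : Type} {W : List γ} {U : List β} {V : List α}
    (hWU : Encounters W U) (hUV : Encounters U V) : Encounters W V := by
  obtain ⟨W', hW', ψ, hψ, rfl⟩ := hWU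
  obtain ⟨_, ⟨s, t, rfl⟩, φ, hφ, rfl⟩ := hUV
  refine ⟨(((V.map φ).flatten).map ψ).flatten,
    List.IsInfix.trans ⟨(s.map ψ).flatten, (t.map ψ).flatten, by simp⟩ hW',
    fun a => ((φ a).map ψ).flatten, ?_, ?_⟩
  · intro a ha
    obtain ⟨b, l, hb⟩ := List.exists_cons_of_ne_nil (hφ a ha)
    have hmem : b ∈ φ a := by simp [hb]
    have hb' : ψ b ≠ [] := hψ b (by simp only [List.mem_append, List.mem_flatten, List.mem_map]
                                    exact Or.inl (Or.inr ⟨φ a, ⟨a, ha, rfl⟩, hmem⟩))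
    simp [hb, hb']
  · clear hφ hψ hW'
    induction V with
    | nil => simp
    | cons a V ih => simp_all

theorem Encounters.map {α β γ : Type} {W : List β} {V : List α} (f : β → γ)
    (h : Encounters W V) : Encounters (W.map f) V := by
  obtain ⟨W', hW', φ, hφ, rfl⟩ := h
  refine ⟨_, hW'.map f, fun a => (φ a).map f, fun a ha => by simpa using hφ a ha, ?_⟩
  simp [List.map_flatten, List.map_map, Function.comp_def]

theorem Encounters.zimin_mono {α : Type} {V : List α} {m n : ℕ} (hmn : m ≤ n)
    (h : Encounters (Zimin m) V) : Encounters (Zimin n) V := by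
  induction n, hmn using Nat.le_induction with
  | base => exact h
  | succ n _ ih => exact ih.mono_left ⟨[], n :: Zimin n, by simp [Zimin]⟩

/-! ### Zimin words are unavoidable -/

theorem lt_of_mem_zimin {n k : ℕ} (h : k ∈ Zimin n) : k < n := by
  induction n with
  | zero => simp [Zimin] at h
  | succ n ih =>
    simp only [Zimin, List.mem_append, List.mem_cons] at h
    rcases h with h | rfl | h
    · exact (ih h).trans (Nat.lt_succ_self n)
    · exact Nat.lt_succ_self _
    · exact (ih h).trans (Nat.lt_succ_self n)

theorem encounters_zimin_succ {β : Type} {n : ℕ} {B g : List β}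
    (hB : Encounters B (Zimin n)) (hg : g ≠ []) :
    Encounters (B ++ g ++ B) (Zimin (n + 1)) := by
  obtain ⟨_, ⟨s, t, rfl⟩, φ, hφ, rfl⟩ := hB
  have hmap : (Zimin n).map (fun k => if k = n then t ++ g ++ s else φ k) =
      (Zimin n).map φ :=
    List.map_congr_left fun k hk => by simp [(lt_of_mem_zimin hk).ne]
  refine ⟨((Zimin n).map φ).flatten ++ (t ++ g ++ s) ++ ((Zimin n).map φ).flatten,
    ⟨s, t, by simp⟩, fun k => if k = n then t ++ g ++ s else φ k, ?_, ?_⟩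
  · intro k hk
    by_cases hkn : k = n
    · simp [hkn, hg]
    · simp only [Zimin, List.mem_append, List.mem_cons, hkn, false_or, or_self] at hk
      simpa [hkn] using hφ k hk
  · simp only [Zimin, List.map_append, List.map_cons, hmap, List.flatten_append,
      List.flatten_cons]
    simp

theorem exists_length_encounters_zimin (n q : ℕ) :
    ∃ M : ℕ, ∀ W : List (Fin q), M ≤ W.length → Encounters W (Zimin n) := by
  induction n with
  | zero =>
    exact ⟨0, fun W _ => ⟨[], by simp, fun _ => [], by simp [Zimin], by simp [Zimin]⟩⟩
  | succ n ih =>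
    obtain ⟨M, hM⟩ := ih
    set K := Fintype.card (List.Vector (Fin q) M)
    refine ⟨(M + 1) * (K + 1), fun W hW => ?_⟩
    have hlen (i : Fin (K + 1)) : ((W.drop (i * (M + 1))).take M).length = M := by
      have h1 : (i : ℕ) + 1 ≤ K + 1 := i.2
      have h2 := Nat.mul_le_mul_left (M + 1) h1
      have h3 : (M + 1) * ((i : ℕ) + 1) = i * (M + 1) + (M + 1) := by ring
      simp only [List.length_take, List.length_drop]
      omega
    let f (i : Fin (K + 1)) : List.Vector (Fin q) M :=
      ⟨(W.drop (i * (M + 1))).take M, hlen i⟩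
    obtain ⟨i, j, hij, hf⟩ : ∃ i j : Fin (K + 1), i < j ∧ f i = f j := by
      obtain ⟨i, j, hne, hf⟩ := Fintype.exists_ne_map_eq_of_card_lt f (by simp [K])
      rcases lt_or_gt_of_ne hne with h | h
      · exact ⟨i, j, h, hf⟩
      · exact ⟨j, i, h, hf.symm⟩
    have hB : (W.drop (i * (M + 1))).take M = (W.drop (j * (M + 1))).take M :=
      congrArg Subtype.val hf
    have hj := hlen j
    set B := (W.drop (j * (M + 1))).take M
    obtain ⟨d, hd⟩ : ∃ d : ℕ, (j : ℕ) * (M + 1) = i * (M + 1) + M + (d + 1) := by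
      have h2 := Nat.mul_le_mul_right (M + 1) (show (i : ℕ) + 1 ≤ j from hij)
      rw [Nat.succ_mul] at h2
      exact ⟨j * (M + 1) - (i * (M + 1) + M + 1), by omega⟩
    have h1 : W.drop (i * (M + 1)) = B ++ W.drop (i * (M + 1) + M) := by
      rw [← hB, ← List.drop_drop, List.take_append_drop]
    have h2 : W.drop (i * (M + 1) + M) =
        (W.drop (i * (M + 1) + M)).take (d + 1) ++ W.drop (j * (M + 1)) := by
      rw [hd, ← List.drop_drop (i := d + 1), List.take_append_drop]
    have h3 : W.drop (j * (M + 1)) = B ++ (W.drop (j * (M + 1))).drop M :=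
      (List.take_append_drop _ _).symm
    have hne : (W.drop (i * (M + 1) + M)).take (d + 1) ≠ [] := by
      have hk : (j : ℕ) * (M + 1) < W.length := by
        have h4 := Nat.mul_le_mul_right (M + 1) (show (j : ℕ) + 1 ≤ K + 1 from j.2)
        rw [Nat.succ_mul, mul_comm (K + 1)] at h4
        omega
      apply List.ne_nil_of_length_pos
      simp only [List.length_take, List.length_drop]
      omega
    refine (encounters_zimin_succ (hM B hj.ge) hne).mono_left
      ⟨W.take (i * (M + 1)), (W.drop (j * (M + 1))).drop M, ?_⟩
    conv_rhs => rw [← List.take_append_drop (i * (M + 1)) W, h1, h2, h3]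
    simp

theorem finite_avoids_zimin (n q : ℕ) : {W : List (Fin q) | Avoids W (Zimin n)}.Finite := by
  obtain ⟨M, hM⟩ := exists_length_encounters_zimin n q
  refine (List.finite_length_lt (Fin q) M).subset fun W hW => ?_
  by_contra hlt
  exact hW (hM W (not_lt.mp hlt))

/-! ### Deleting letters from patterns encountered by Zimin words -/

/-- Raise every letter by one and insert a `0` after it. -/
def interleaveZero (w : List ℕ) : List ℕ := w.flatMap fun k => [k + 1, 0]

theorem interleaveZero_append (v w : List ℕ) :
    interleaveZero (v ++ w) = interleaveZero v ++ interleaveZero w := by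
  simp [interleaveZero]

theorem zero_cons_interleaveZero (w : List ℕ) :
    0 :: interleaveZero w = (w.flatMap fun k => [0, k + 1]) ++ [0] := by
  induction w with
  | nil => rfl
  | cons k w ih => simpa [interleaveZero] using ih

theorem exists_interleaveZero_eq_concat {w : List ℕ} (hw : w ≠ []) :
    ∃ t, t ≠ [] ∧ interleaveZero w = t ++ [0] := by
  obtain ⟨k, l, rfl⟩ := List.exists_cons_of_ne_nil hw
  have h := zero_cons_interleaveZero l
  exact ⟨(k + 1) :: l.flatMap fun k => [0, k + 1], by simp, by simpa [interleaveZero] using h⟩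

theorem zimin_succ_eq_interleaveZero (n : ℕ) :
    Zimin (n + 1) = 0 :: interleaveZero (Zimin n) := by
  induction n with
  | zero => rfl
  | succ n ih =>
    have h₁ : Zimin (n + 2) = Zimin (n + 1) ++ (n + 1) :: Zimin (n + 1) := rfl
    have h₂ : interleaveZero (Zimin (n + 1)) =
        interleaveZero (Zimin n) ++ (n + 1) :: 0 :: interleaveZero (Zimin n) := by
      rw [Zimin, interleaveZero_append]
      simp [interleaveZero]
    rw [h₁, h₂, ih]
    simp

/-- The letters of the word label consecutive edges, `x` running from `s x` to `e x`,
of a walk between two given vertices. -/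
def LabelWalk {α : Type} (s e : α → ℕ) : List α → ℕ → ℕ → Prop
  | [], p, q => p = q
  | x :: u, p, q => s x = p ∧ LabelWalk s e u (e x) q

theorem LabelWalk.map {α : Type} {s e : α → ℕ} (f : ℕ → ℕ) {u : List α} {p q : ℕ}
    (h : LabelWalk s e u p q) : LabelWalk (f ∘ s) (f ∘ e) u (f p) (f q) := by
  induction u generalizing p with
  | nil => exact congrArg f h
  | cons x u ih => exact ⟨congrArg f h.1, ih h.2⟩

theorem LabelWalk.filter {α : Type} [DecidableEq α] {s e : α → ℕ} {A : Finset α}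
    (hA : ∀ x ∈ A, s x = e x) {u : List α} {p q : ℕ} (h : LabelWalk s e u p q) :
    LabelWalk s e (u.filter (· ∉ A)) p q := by
  induction u generalizing p with
  | nil => exact h
  | cons x u ih =>
    obtain ⟨rfl, h⟩ := h
    by_cases hx : x ∈ A
    · rw [List.filter_cons_of_neg (by simpa using hx), hA x hx]
      exact ih h
    · rw [List.filter_cons_of_pos (by simpa using hx)]
      exact ⟨rfl, ih h⟩

theorem flatten_map_filter_notMem {α β : Type} [DecidableEq α] (A : Finset α)
    (φ : α → List β) (u : List α) :
    ((u.filter (· ∉ A)).map φ).flatten =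
      (u.map fun x => if x ∈ A then [] else φ x).flatten := by
  induction u with
  | nil => rfl
  | cons x u ih => by_cases hx : x ∈ A <;> simp_all

theorem encounters_zimin_succ_of_filter {α : Type} [DecidableEq α] {s e : α → ℕ}
    {A : Finset α} {E m p q : ℕ} (hs : ∀ x ∈ A, s x ≠ E) (he : ∀ x ∈ A, e x = E)
    {u : List α} (hu : LabelWalk s e u p q)
    (h : Encounters (Zimin m) (u.filter (· ∉ A))) : Encounters (Zimin (m + 1)) u := by
  obtain ⟨_, ⟨P, Q, hPQ⟩, φ, hφ, rfl⟩ := h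
  rw [flatten_map_filter_notMem] at hPQ
  let φ₀ (x : α) : List ℕ := if x ∈ A then [] else φ x
  let z (k : ℕ) : List ℕ := if k = E then [] else [0]
  have key (x : α) (hx : x ∈ u) :
      ∃ w, w ≠ [] ∧ w ++ z (e x) = z (s x) ++ interleaveZero (φ₀ x) := by
    by_cases hxA : x ∈ A
    · exact ⟨[0], by simp, by simp [z, φ₀, hs x hxA, he x hxA, hxA, interleaveZero]⟩
    · obtain ⟨t, ht, hw⟩ := exists_interleaveZero_eq_concat
        (hφ x (by simpa using ⟨hx, hxA⟩))
      simp only [φ₀, hxA, if_false, hw]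
      by_cases hE : e x = E
      · exact ⟨z (s x) ++ (t ++ [0]), by simp, by simp [z, hE]⟩
      · exact ⟨z (s x) ++ t, by simp [ht], by simp [z, hE]⟩
  choose! ψ hψ hψe using key
  have tel : ∀ (v : List α) (p : ℕ), (∀ x ∈ v, x ∈ u) → LabelWalk s e v p q →
      (v.map ψ).flatten ++ z q = z p ++ interleaveZero (v.map φ₀).flatten := by
    intro v
    induction v with
    | nil =>
      intro p _ hv
      have hpq : p = q := hv
      simp [hpq, interleaveZero]
    | cons x v ih =>
      rintro p hmem ⟨rfl, hv⟩
      have h1 := ih _ (fun y hy => hmem y (List.mem_cons_of_mem _ hy)) hv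
      simp only [List.map_cons, List.flatten_cons, interleaveZero_append, List.append_assoc, h1]
      rw [← List.append_assoc, hψe x (hmem x List.mem_cons_self), List.append_assoc]
  refine ⟨(u.map ψ).flatten, ?_, ψ, hψ, rfl⟩
  have h1 := tel u p (fun _ hx => hx) hu
  have h2 : (u.map ψ).flatten <:+: 0 :: interleaveZero (u.map φ₀).flatten := by
    have h3 : (u.map ψ).flatten <:+: z p ++ interleaveZero (u.map φ₀).flatten :=
      ⟨[], z q, by simpa using h1⟩
    refine h3.trans ?_
    by_cases hp : p = E
    · exact ⟨[0], [], by simp [z, hp]⟩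
    · exact ⟨[], [], by simp [z, hp]⟩
  refine h2.trans ⟨P.flatMap fun k => [0, k + 1], interleaveZero Q, ?_⟩
  rw [zimin_succ_eq_interleaveZero, ← hPQ, interleaveZero_append, interleaveZero_append,
    ← List.cons_append, ← List.cons_append, zero_cons_interleaveZero P]
  simp [φ₀]

theorem encounters_zimin_add_of_filter {α : Type} [DecidableEq α] {m k : ℕ} {s e : α → ℕ}
    {A : Finset α} (hk : A.card ≤ k) (hA : ∀ x ∈ A, s x < e x) {u : List α} {p q : ℕ}
    (hu : LabelWalk s e u p q) (h : Encounters (Zimin m) (u.filter (· ∉ A))) :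
    Encounters (Zimin (m + k)) u := by
  induction k generalizing s e A u p q with
  | zero =>
    obtain rfl : A = ∅ := by simpa using hk
    simpa using h
  | succ k ih =>
    rcases A.eq_empty_or_nonempty with rfl | hne
    · exact Encounters.zimin_mono (Nat.le_add_right _ _) (by simpa using h)
    · obtain ⟨a, ha, hmin⟩ := A.exists_min_image e hne
      set A₁ := A.filter (e · = e a)
      have hA₁ : ∀ x ∈ A₁, x ∈ A ∧ e x = e a := fun x hx => by simpa [A₁] using hx
      refine encounters_zimin_succ_of_filter (A := A₁) (E := e a)
        (fun x hx => ?_) (fun x hx => (hA₁ x hx).2) hu ?_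
      · rw [← (hA₁ x hx).2]
        exact (hA x (hA₁ x hx).1).ne
      · refine ih (s := (max (e a)) ∘ s) (e := (max (e a)) ∘ e) (A := A \ A₁) ?_ ?_
          ((hu.map (max (e a))).filter ?_) ?_
        · have h1 : (A \ A₁).card < A.card := Finset.card_lt_card
            ⟨Finset.sdiff_subset, fun hsub => (Finset.mem_sdiff.mp (hsub ha)).2 (by simp [A₁, ha])⟩
          omega
        · intro x hx
          simp only [A₁, Finset.mem_sdiff, Finset.mem_filter, not_and] at hx
          have h1 := hmin x hx.1
          have h2 := hx.2 hx.1
          have h3 := hA x hx.1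
          simp only [Function.comp]
          omega
        · intro x hx
          have h1 := hA₁ x hx
          have h2 := hA x h1.1
          simp only [Function.comp]
          omega
        · rw [List.filter_filter]
          convert h using 2
          ext x
          by_cases hx : x ∈ A₁
          · simp [hx, (hA₁ x hx).1]
          · simp [hx]

/-! ### An infinite word over a finite alphabet -/

/-- The fixed point of the substitution `(i, j) ↦ (i, 0) (j, 1) (i, 2) (j, 3) ⋯` of length
`n + 2`. -/
def gridWord (n p : ℕ) : ℕ × ℕ :=
  if h : p = 0 then (0, 0)
  else
    have : p / (n + 2) < p := Nat.div_lt_self (Nat.pos_of_ne_zero h) (by omega)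
    (if p % (n + 2) % 2 = 0 then (gridWord n (p / (n + 2))).1 else (gridWord n (p / (n + 2))).2,
      p % (n + 2))
  termination_by p

theorem gridWord_eq (n p : ℕ) : gridWord n p =
    (if p % (n + 2) % 2 = 0 then (gridWord n (p / (n + 2))).1 else (gridWord n (p / (n + 2))).2,
      p % (n + 2)) := by
  by_cases h : p = 0
  · subst h
    simp [gridWord]
  · rw [gridWord, dif_neg h]

theorem gridWord_lt (n p : ℕ) : (gridWord n p).1 < n + 2 ∧ (gridWord n p).2 < n + 2 := by
  induction p using Nat.strong_induction_on with
  | _ p ih =>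
    by_cases h : p = 0
    · subst h
      simp [gridWord]
    · have hlt : p / (n + 2) < p := Nat.div_lt_self (Nat.pos_of_ne_zero h) (by omega)
      rw [gridWord_eq]
      refine ⟨?_, Nat.mod_lt _ (by omega)⟩
      dsimp only
      split_ifs
      exacts [(ih _ hlt).1, (ih _ hlt).2]

theorem gridWord_mul_add (n k c : ℕ) (hc : c < n + 2) : gridWord n (k * (n + 2) + c) =
    (if c % 2 = 0 then (gridWord n k).1 else (gridWord n k).2, c) := by
  have hdiv : (k * (n + 2) + c) / (n + 2) = k := by
    rw [mul_comm, Nat.mul_add_div (by omega), Nat.div_eq_of_lt hc, add_zero]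
  have hmod : (k * (n + 2) + c) % (n + 2) = c := by
    rw [mul_comm, Nat.mul_add_mod, Nat.mod_eq_of_lt hc]
  rw [gridWord_eq, hdiv, hmod]

theorem gridWord_eq_of_adjacent {n k k' c : ℕ} (hc : c + 1 < n + 2)
    (h₀ : gridWord n (k * (n + 2) + c) = gridWord n (k' * (n + 2) + c))
    (h₁ : gridWord n (k * (n + 2) + (c + 1)) = gridWord n (k' * (n + 2) + (c + 1))) :
    gridWord n k = gridWord n k' := by
  rw [gridWord_mul_add _ _ _ (by omega), gridWord_mul_add _ _ _ (by omega)] at h₀ h₁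
  rcases Nat.mod_two_eq_zero_or_one c with h | h
  · have h' : (c + 1) % 2 = 1 := by omega
    simp only [h, h', if_true, Prod.mk.injEq, and_true, one_ne_zero, if_false] at h₀ h₁
    exact Prod.ext h₀ h₁
  · have h' : (c + 1) % 2 = 0 := by omega
    simp only [h, h', if_true, Prod.mk.injEq, and_true, one_ne_zero, if_false] at h₀ h₁
    exact Prod.ext h₁ h₀

/-- For `c < n + 2`, the number of positions below `p` congruent to `c` modulo `n + 2`. -/
def markerCount (n c p : ℕ) : ℕ := (p + (n + 1 - c)) / (n + 2)

/-- The distance from `p` back to the last position congruent to `c` modulo `n + 2`, less one. -/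
def markerOffset (n c p : ℕ) : ℕ := (p + (n + 1 - c)) % (n + 2)

theorem markerCount_mono (n c : ℕ) : Monotone (markerCount n c) := fun _ _ h =>
  Nat.div_le_div_right (Nat.add_le_add_right h _)

theorem markerCount_mul_add (n c k d : ℕ) :
    markerCount n c (k * (n + 2) + d) = k + markerCount n c d := by
  rw [markerCount, markerCount, add_assoc, mul_comm, Nat.mul_add_div (by omega)]

theorem markerCount_succ_le {n c N : ℕ} (hc : 1 ≤ c) : markerCount n c (N + 1) ≤ N := by
  rw [markerCount, ← Nat.lt_succ_iff, Nat.div_lt_iff_lt_mul (by omega)]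
  have h : (N + 1) * (n + 2) = N * n + N + N + n + 2 := by ring
  rw [Nat.succ_eq_add_one, h]
  have := Nat.zero_le (N * n)
  omega

theorem markerCount_add_add {n c p p' : ℕ} (h : p % (n + 2) = p' % (n + 2)) (ℓ : ℕ) :
    markerCount n c (p + ℓ) + markerCount n c p' =
      markerCount n c (p' + ℓ) + markerCount n c p := by
  rw [← Nat.div_add_mod' p (n + 2), ← Nat.div_add_mod' p' (n + 2), h, add_assoc, add_assoc]
  simp only [markerCount_mul_add]
  omega

theorem markerOffset_lt {n c p ℓ : ℕ} (hℓ : 0 < ℓ)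
    (h : markerCount n c (p + ℓ) = markerCount n c p) :
    markerOffset n c p < markerOffset n c (p + ℓ) := by
  have h₁ := Nat.div_add_mod' (p + (n + 1 - c)) (n + 2)
  have h₂ := Nat.div_add_mod' (p + ℓ + (n + 1 - c)) (n + 2)
  simp only [markerCount] at h
  rw [h] at h₂
  simp only [markerOffset]
  omega

theorem markerOffset_congr {n c p p' : ℕ} (h : p % (n + 2) = p' % (n + 2)) (ℓ : ℕ) :
    markerOffset n c (p + ℓ) = markerOffset n c (p' + ℓ) :=
  Nat.ModEq.add_right _ (Nat.ModEq.add_right ℓ h)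

theorem gridWord_desubstitute {n c ℓ p p' : ℕ} (hc : 1 ≤ c) (hcn : c < n + 2)
    (hpc : p % (n + 2) ≠ c) (hpp : p % (n + 2) = p' % (n + 2))
    (h : ∀ i < ℓ, gridWord n (p + i) = gridWord n (p' + i)) {i : ℕ}
    (hi : markerCount n c p + i < markerCount n c (p + ℓ)) :
    gridWord n (markerCount n c p + i) = gridWord n (markerCount n c p' + i) := by
  obtain ⟨k, d, k', hd, rfl, rfl⟩ : ∃ k d k', d < n + 2 ∧ p = k * (n + 2) + d ∧
      p' = k' * (n + 2) + d := ⟨p / (n + 2), p % (n + 2), p' / (n + 2), Nat.mod_lt _ (by omega),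
    (Nat.div_add_mod' _ _).symm, by rw [hpp, Nat.div_add_mod']⟩
  have hdc : d ≠ c := by
    rwa [mul_comm, Nat.mul_add_mod, Nat.mod_eq_of_lt hd] at hpc
  rw [add_assoc] at hi
  simp only [markerCount_mul_add] at hi ⊢
  set j := markerCount n c d + i
  have hj : j + 1 ≤ markerCount n c (d + ℓ) := by omega
  rw [markerCount, Nat.le_div_iff_mul_le (by omega), Nat.succ_mul] at hj
  have hdj : d < j * (n + 2) + c := by
    have h₁ := Nat.div_add_mod' (d + (n + 1 - c)) (n + 2)
    have h₂ := Nat.mod_lt (d + (n + 1 - c)) (show n + 2 > 0 by omega)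
    have h₃ : (d + (n + 1 - c)) / (n + 2) * (n + 2) ≤ j * (n + 2) :=
      Nat.mul_le_mul_right _ (Nat.le_add_right _ i)
    rcases Nat.eq_zero_or_pos j with h₀ | h₀
    · rw [h₀, zero_mul] at h₃ ⊢
      omega
    · have := Nat.le_mul_of_pos_left (n + 2) h₀
      omega
  obtain ⟨t, ht⟩ : ∃ t, j * (n + 2) + c = d + (t + 1) := ⟨j * (n + 2) + c - d - 1, by omega⟩
  obtain ⟨c, rfl⟩ : ∃ c', c = c' + 1 := ⟨c - 1, by omega⟩
  rw [add_assoc k, add_assoc k']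
  apply gridWord_eq_of_adjacent hcn
  · have h₁ := h t (by omega)
    rwa [show k * (n + 2) + d + t = (k + j) * (n + 2) + c by rw [Nat.add_mul]; omega,
      show k' * (n + 2) + d + t = (k' + j) * (n + 2) + c by rw [Nat.add_mul]; omega] at h₁
  · have h₁ := h (t + 1) (by omega)
    rwa [show k * (n + 2) + d + (t + 1) = (k + j) * (n + 2) + (c + 1) by rw [Nat.add_mul]; omega,
      show k' * (n + 2) + d + (t + 1) = (k' + j) * (n + 2) + (c + 1) by
        rw [Nat.add_mul]; omega] at h₁

/-- The pattern has an instance in the grid word between two given positions, where the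
letter `x` is replaced by a copy of the factor of length `ℓ x` at position `a x`. -/
def GridOccurs {α : Type} (n : ℕ) (a ℓ : α → ℕ) : List α → ℕ → ℕ → Prop
  | [], p, q => p = q
  | x :: u, p, q =>
    (∀ i < ℓ x, gridWord n (p + i) = gridWord n (a x + i)) ∧ GridOccurs n a ℓ u (p + ℓ x) q

theorem GridOccurs.le {α : Type} {n : ℕ} {a ℓ : α → ℕ} {u : List α} {p q : ℕ}
    (h : GridOccurs n a ℓ u p q) : p ≤ q := by
  induction u generalizing p with
  | nil => exact Eq.le h
  | cons x u ih => exact (Nat.le_add_right _ _).trans (ih h.2)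

theorem mod_eq_of_gridWord_eq {n p p' ℓ : ℕ} (hℓ : 0 < ℓ)
    (h : ∀ i < ℓ, gridWord n (p + i) = gridWord n (p' + i)) : p % (n + 2) = p' % (n + 2) := by
  have h₁ := congrArg Prod.snd (h 0 hℓ)
  rwa [gridWord_eq, gridWord_eq n (p' + 0)] at h₁

theorem GridOccurs.labelWalk {α : Type} {n c : ℕ} {a ℓ : α → ℕ} {u : List α} {p q : ℕ}
    (hℓ : ∀ x ∈ u, 0 < ℓ x) (h : GridOccurs n a ℓ u p q) :
    LabelWalk (fun x => markerOffset n c (a x)) (fun x => markerOffset n c (a x + ℓ x)) u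
      (markerOffset n c p) (markerOffset n c q) := by
  induction u generalizing p with
  | nil => exact congrArg _ h
  | cons x u ih =>
    have hmod := mod_eq_of_gridWord_eq (hℓ x List.mem_cons_self) h.1
    refine ⟨(markerOffset_congr hmod 0).symm, ?_⟩
    beta_reduce
    rw [← markerOffset_congr hmod]
    exact ih (fun y hy => hℓ y (List.mem_cons_of_mem _ hy)) h.2

theorem GridOccurs.desubstitute {α : Type} [DecidableEq α] {n c : ℕ} {a ℓ : α → ℕ}
    {A : Finset α} {u : List α} {p q : ℕ} (hc : 1 ≤ c) (hcn : c < n + 2)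
    (hac : ∀ x ∈ u, a x % (n + 2) ≠ c) (hℓ : ∀ x ∈ u, 0 < ℓ x)
    (hA : ∀ x ∈ A, markerCount n c (a x + ℓ x) = markerCount n c (a x))
    (h : GridOccurs n a ℓ u p q) :
    GridOccurs n (fun x => markerCount n c (a x))
      (fun x => markerCount n c (a x + ℓ x) - markerCount n c (a x)) (u.filter (· ∉ A))
      (markerCount n c p) (markerCount n c q) := by
  induction u generalizing p with
  | nil => exact congrArg _ h
  | cons x u ih =>
    have hmod := mod_eq_of_gridWord_eq (hℓ x List.mem_cons_self) h.1
    have hcount := markerCount_add_add (c := c) hmod (ℓ x)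
    have hmono := markerCount_mono n c (Nat.le_add_right (a x) (ℓ x))
    have htail := ih (fun y hy => hac y (List.mem_cons_of_mem _ hy))
      (fun y hy => hℓ y (List.mem_cons_of_mem _ hy)) h.2
    by_cases hx : x ∈ A
    · rw [List.filter_cons_of_neg (by simpa using hx)]
      have h₁ := hA x hx
      rwa [show markerCount n c (p + ℓ x) = markerCount n c p by omega] at htail
    · rw [List.filter_cons_of_pos (by simpa using hx)]
      refine ⟨fun i hi => gridWord_desubstitute hc hcn ?_ hmod h.1 (by
        beta_reduce at hi; omega), ?_⟩
      · rw [hmod]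
        exact hac x List.mem_cons_self
      · rwa [show markerCount n c p + (markerCount n c (a x + ℓ x) - markerCount n c (a x)) =
          markerCount n c (p + ℓ x) by omega]

theorem GridOccurs.encounters_zimin {α : Type} [DecidableEq α] {n N : ℕ} {a ℓ : α → ℕ}
    {u : List α} {p q : ℕ} (hu : u.toFinset.card ≤ n) (hℓ : ∀ x ∈ u, 0 < ℓ x)
    (hq : q ≤ N) (h : GridOccurs n a ℓ u p q) :
    Encounters (Zimin u.toFinset.card) u := by
  induction N generalizing a ℓ u p q with
  | zero =>
    cases u with
    | nil => exact ⟨[], by simp, fun _ => [], by simp, by simp⟩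
    | cons x u =>
      have h₁ := h.2.le
      have h₂ := hℓ x List.mem_cons_self
      omega
  | succ N ih =>
    obtain ⟨c, hc, hcu⟩ : ∃ c ∈ Finset.Ico 1 (n + 2),
        c ∉ u.toFinset.image fun x => a x % (n + 2) := by
      apply Finset.exists_mem_notMem_of_card_lt_card
      rw [Nat.card_Ico]
      have := Finset.card_image_le (s := u.toFinset) (f := fun x => a x % (n + 2))
      omega
    rw [Finset.mem_Ico] at hc
    have hac : ∀ x ∈ u, a x % (n + 2) ≠ c := fun x hx hxc =>
      hcu (Finset.mem_image.mpr ⟨x, List.mem_toFinset.mpr hx, hxc⟩)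
    set A := u.toFinset.filter fun x => markerCount n c (a x + ℓ x) = markerCount n c (a x)
      with hAdef
    have hA : ∀ x ∈ A, x ∈ u ∧ markerCount n c (a x + ℓ x) = markerCount n c (a x) :=
      fun x hx => by simpa [A] using hx
    have hsub : A ⊆ u.toFinset := Finset.filter_subset _ _
    have hset : (u.filter (· ∉ A)).toFinset = u.toFinset \ A := by
      ext x
      simp
    have hcard : (u.filter (· ∉ A)).toFinset.card + A.card = u.toFinset.card := by
      rw [hset, Finset.card_sdiff_add_card_eq_card hsub]
    rw [← hcard]
    refine encounters_zimin_add_of_filter le_rfl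
      (fun x hx => markerOffset_lt (hℓ x (hA x hx).1) (hA x hx).2) (h.labelWalk (c := c) hℓ) ?_
    refine ih (by omega) (fun x hx => ?_) ?_
      (h.desubstitute hc.1 hc.2 hac hℓ fun x hx => (hA x hx).2)
    · have hx' : x ∈ u ∧ x ∉ A := by simpa using hx
      have hne : markerCount n c (a x + ℓ x) ≠ markerCount n c (a x) := fun heq =>
        hx'.2 (by rw [hAdef, Finset.mem_filter, List.mem_toFinset]; exact ⟨hx'.1, heq⟩)
      have := markerCount_mono n c (Nat.le_add_right (a x) (ℓ x))
      omega
    · exact (markerCount_mono n c hq).trans (markerCount_succ_le hc.1)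

theorem encounters_zimin_of_encounters_gridWord {α : Type} [DecidableEq α] {V : List α} {N : ℕ}
    (h : Encounters ((List.range N).map (gridWord V.toFinset.card)) V) :
    Encounters (Zimin V.toFinset.card) V := by
  classical
  set n := V.toFinset.card
  obtain ⟨_, ⟨P, Q, hPQ⟩, φ, hφ, rfl⟩ := h
  let occ (x : α) (p : ℕ) : Prop := ∀ i (hi : i < (φ x).length), (φ x)[i] = gridWord n (p + i)
  let a (x : α) : ℕ := if hx : ∃ p, occ x p then hx.choose else 0
  have ha (x : α) (p : ℕ) (hp : occ x p) : occ x (a x) := by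
    have hx : ∃ p, occ x p := ⟨p, hp⟩
    simp only [a, dif_pos hx]
    exact hx.choose_spec
  have key : ∀ (v : List α) (p : ℕ), (∀ i (hi : i < (v.map φ).flatten.length),
      (v.map φ).flatten[i] = gridWord n (p + i)) →
      GridOccurs n a (fun x => (φ x).length) v p (p + (v.map φ).flatten.length) := by
    intro v
    induction v with
    | nil => exact fun p _ => rfl
    | cons x v ih =>
      intro p hv
      simp only [List.map_cons, List.flatten_cons, List.length_append] at hv ⊢
      have hx : occ x p := fun i hi => by
        rw [← hv i (by omega), List.getElem_append_left hi]
      refine ⟨fun i hi => by rw [← hx i hi, ← ha x p hx i hi], ?_⟩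
      rw [← add_assoc]
      refine ih _ fun i hi => ?_
      rw [add_assoc, ← hv ((φ x).length + i) (by omega), List.getElem_append_right (by omega)]
      simp
  refine (key V P.length fun i hi => ?_).encounters_zimin le_rfl
    (fun x hx => List.length_pos_of_ne_nil (hφ x hx)) le_rfl
  have hget : ((List.range N).map (gridWord n))[P.length + i]? =
      some ((V.map φ).flatten[i]) := by
    rw [← hPQ, List.append_assoc, List.getElem?_append_right (by omega),
      List.getElem?_append_left (by omega), Nat.add_sub_cancel_left, List.getElem?_eq_getElem hi]
  simp only [List.getElem?_map, Option.map_eq_some_iff, List.getElem?_eq_some_iff,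
    List.getElem_range] at hget
  obtain ⟨_, ⟨_, rfl⟩, hg⟩ := hget
  exact hg.symm

theorem exists_encounters_gridWord {α : Type} {V : List α} (n : ℕ)
    (h : ∀ q : ℕ, 0 < q → {W : List (Fin q) | Avoids W V}.Finite) :
    ∃ N, Encounters ((List.range N).map (gridWord n)) V := by
  by_contra! hN
  let letter (p : ℕ) : Fin (n + 2) × Fin (n + 2) :=
    (⟨(gridWord n p).1, (gridWord_lt n p).1⟩, ⟨(gridWord n p).2, (gridWord_lt n p).2⟩)
  let f (N : ℕ) : List (Fin ((n + 2) * (n + 2))) :=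
    (List.range N).map fun p => finProdFinEquiv (letter p)
  have hf_inj : f.Injective := fun N N' hf => by simpa [f] using congrArg List.length hf
  have hf_avoids (N : ℕ) : Avoids (f N) V := fun hf => by
    have hmap := hf.map fun y =>
      ((((finProdFinEquiv.symm y).1 : ℕ), ((finProdFinEquiv.symm y).2 : ℕ)) : ℕ × ℕ)
    simp only [f, List.map_map, Function.comp_def, Equiv.symm_apply_apply] at hmap
    exact hN N hmap
  exact Set.infinite_of_injective_forall_mem hf_inj hf_avoids
    (h ((n + 2) * (n + 2)) (by positivity))

/-- Zimin's theorem (1982): a word `V` with exactly `n` distinct letters is unavoidable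
(for every positive `q`, only finitely many `q`-ary words avoid `V`) if and only if
`Zₙ` encounters `V`. -/
theorem zimin_classification (α : Type) [DecidableEq α] (V : List α) (n : ℕ)
    (h : V.toFinset.card = n) :
    (∀ q : ℕ, 0 < q → {W : List (Fin q) | Avoids W V}.Finite) ↔
      Encounters (Zimin n) V := by
  subst h
  refine ⟨fun hV => ?_, fun hV q _ => ?_⟩
  · obtain ⟨N, hN⟩ := exists_encounters_gridWord V.toFinset.card hV
    exact encounters_zimin_of_encounters_gridWord hN
  · exact (finite_avoids_zimin _ q).subset fun W hW hWZ => hW (hWZ.trans hV)
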